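/- The trivariate second-order Eulerian polynomial C_n(x,y,z) = Σ_{σ ∈ Q_n} x^{asc(σ)} y^{plat(σ)} z^{des(σ)} is a symmetric polynomial in x, y, z; in particular, the plateau statistic plat and the descent statistic des are equidistributed over Q_n. -/

import Mathlib

/-- A Stirling permutation of the multiset {1,1,2,2,...,n,n}. -/
def IsStirling (n : ℕ) (σ : List ℕ) : Prop :=
  (∀ m : ℕ, σ.count m = if 1 ≤ m ∧ m ≤ n then 2 else 0) ∧
  (∀ i s j : ℕ, i < s → s < j → j < σ.length →
    σ.getD i 0 = σ.getD j 0 → σ.getD i 0 < σ.getD s 0)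

/-- Entry of `σ` in 1-based indexing, with the boundary convention
`σ_0 = 0` and `σ_i = 0` for `i > length σ`. -/
def ent (σ : List ℕ) (i : ℕ) : ℕ := if i = 0 then 0 else σ.getD (i - 1) 0

/-- Number of ascents: indices `1 ≤ i ≤ 2n` with `σ_{i-1} < σ_i`. -/
def ascQ (σ : List ℕ) : ℕ :=
  ((Finset.Icc 1 σ.length).filter fun i => ent σ (i - 1) < ent σ i).card

/-- Number of plateaux: indices `1 ≤ i ≤ 2n-1` with `σ_i = σ_{i+1}`. -/
def platQ (σ : List ℕ) : ℕ :=
  ((Finset.Icc 1 (σ.length - 1)).filter fun i => ent σ i = ent σ (i + 1)).card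

/-- Number of descents: indices `1 ≤ i ≤ 2n` with `σ_i > σ_{i+1}` (with `σ_{2n+1} = 0`). -/
def desQ (σ : List ℕ) : ℕ :=
  ((Finset.Icc 1 σ.length).filter fun i => ent σ (i + 1) < ent σ i).card


open MvPolynomial

/-- The trivariate second-order Eulerian polynomial
`C_n(x,y,z) = Σ_{σ ∈ Q_n} x^{asc σ} y^{plat σ} z^{des σ}`, with variables
`x = X 0`, `y = X 1`, `z = X 2`. -/
noncomputable def Cpoly (n : ℕ) : MvPolynomial (Fin 3) ℚ :=
  ∑ᶠ σ ∈ {σ : List ℕ | IsStirling n σ},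
    (X 0 : MvPolynomial (Fin 3) ℚ) ^ ascQ σ * X 1 ^ platQ σ * X 2 ^ desQ σ

namespace Stirling

/-- All words obtained from a word by inserting two adjacent copies of `m`. -/
def insertions (m : ℕ) : List ℕ → List (List ℕ)
  | [] => [[m, m]]
  | b :: l => (m :: m :: b :: l) :: (insertions m l).map (b :: ·)

/-- The Stirling permutations of order `n`, generated by successive insertions. -/
def words : ℕ → List (List ℕ)
  | 0 => [[]]
  | n + 1 => (words n).flatMap (insertions (n + 1))

theorem mem_insertions {m : ℕ} {σ τ : List ℕ} :
    τ ∈ insertions m σ ↔ ∃ u v, σ = u ++ v ∧ τ = u ++ m :: m :: v := by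
  induction σ generalizing τ with
  | nil => simp [insertions]
  | cons b l ih =>
    simp only [insertions, List.mem_cons, List.mem_map, ih]
    constructor
    · rintro (rfl | ⟨_, ⟨u, v, rfl, rfl⟩, rfl⟩)
      · exact ⟨[], b :: l, rfl, rfl⟩
      · exact ⟨b :: u, v, rfl, rfl⟩
    · rintro ⟨_ | ⟨c, u⟩, v, h, rfl⟩
      · left; simp_all
      · right
        simp only [List.cons_append, List.cons.injEq] at h
        obtain ⟨rfl, rfl⟩ := h
        exact ⟨_, ⟨u, v, rfl, rfl⟩, rfl⟩

theorem filter_of_mem_insertions {m : ℕ} {σ τ : List ℕ} (hm : m ∉ σ)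
    (hτ : τ ∈ insertions m σ) : τ.filter (· ≠ m) = σ := by
  obtain ⟨u, v, rfl, rfl⟩ := mem_insertions.1 hτ
  simp only [List.mem_append, not_or] at hm
  have hu : u.filter (· ≠ m) = u :=
    List.filter_eq_self.2 fun a ha => by simpa using fun h : a = m => hm.1 (h ▸ ha)
  have hv : v.filter (· ≠ m) = v :=
    List.filter_eq_self.2 fun a ha => by simpa using fun h : a = m => hm.2 (h ▸ ha)
  rw [List.filter_append, List.filter_cons_of_neg (by simp), List.filter_cons_of_neg (by simp),
    hu, hv]

theorem nodup_insertions {m : ℕ} {σ : List ℕ} (hm : m ∉ σ) : (insertions m σ).Nodup := by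
  induction σ with
  | nil => simp [insertions]
  | cons b l ih =>
    simp only [List.mem_cons, not_or] at hm
    refine List.nodup_cons.2 ⟨?_, (ih hm.2).map (List.cons_injective)⟩
    simp only [List.mem_map, not_exists, not_and]
    intro τ _ h
    exact hm.1 (List.cons.inj h).1.symm

theorem forall_sublist_iff (σ : List ℕ) :
    (∀ i s j : ℕ, i < s → s < j → j < σ.length →
      σ.getD i 0 = σ.getD j 0 → σ.getD i 0 < σ.getD s 0) ↔
    ∀ a b, [a, b, a].Sublist σ → a < b := by
  constructor
  · intro h a b hs
    obtain ⟨f, hf⟩ := List.sublist_iff_exists_orderEmbedding_getElem?_eq.1 hs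
    have h0 := hf 0
    have h1 := hf 1
    have h2 := hf 2
    simp only [List.getElem?_cons_zero, List.getElem?_cons_succ] at h0 h1 h2
    have hlen : f 2 < σ.length := by
      by_contra hc
      rw [List.getElem?_eq_none (by omega)] at h2
      simp at h2
    have := h (f 0) (f 1) (f 2) (f.lt_iff_lt.2 (by norm_num)) (f.lt_iff_lt.2 (by norm_num)) hlen
    simp only [List.getD_eq_getElem?_getD, ← h0, ← h1, ← h2] at this
    simpa using this
  · intro h i s j his hsj hj he
    refine h _ _ ?_
    nth_rewrite 2 [he]
    rw [List.getD_eq_getElem _ _ (by omega), List.getD_eq_getElem _ _ (by omega),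
      List.getD_eq_getElem _ _ hj]
    have := List.map_getElem_sublist (l := σ)
      (is := [⟨i, by omega⟩, ⟨s, by omega⟩, ⟨j, hj⟩]) (by simp; omega)
    simpa using this

theorem isStirling_iff {n : ℕ} {σ : List ℕ} : IsStirling n σ ↔
    (∀ m, σ.count m = if 1 ≤ m ∧ m ≤ n then 2 else 0) ∧
      ∀ a b, [a, b, a].Sublist σ → a < b := by
  rw [IsStirling, forall_sublist_iff]

theorem _root_.IsStirling.mem_iff {n : ℕ} {σ : List ℕ} (h : IsStirling n σ) {m : ℕ} :
    m ∈ σ ↔ 1 ≤ m ∧ m ≤ n := by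
  rw [← List.count_pos_iff, h.1]
  split_ifs <;> simp_all

theorem isStirling_succ_iff {n : ℕ} {τ : List ℕ} :
    IsStirling (n + 1) τ ↔ ∃ σ, IsStirling n σ ∧ τ ∈ insertions (n + 1) σ := by
  constructor
  · intro h
    have hτ := isStirling_iff.1 h
    have hmem : n + 1 ∈ τ := h.mem_iff.2 (by omega)
    obtain ⟨u, t, rfl, hu⟩ := List.eq_append_cons_of_mem hmem
    have hc := hτ.1 (n + 1)
    simp only [List.count_append, List.count_eq_zero.2 hu, List.count_cons_self] at hc
    rw [if_pos (by omega)] at hc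
    obtain _ | ⟨c, v⟩ := t
    · simp at hc
    have hcm : c = n + 1 := by
      by_contra hne
      rw [List.count_cons_of_ne hne] at hc
      have hv : n + 1 ∈ v := List.count_pos_iff.1 (by omega)
      have h1 := hτ.2 (n + 1) c (((List.singleton_sublist.2 hv).cons_cons c).cons_cons (n + 1)
        |>.trans (List.sublist_append_right _ _))
      have h2 := (h.mem_iff (m := c)).1 (by simp)
      omega
    subst hcm
    refine ⟨u ++ v, isStirling_iff.2 ⟨fun m => ?_, fun a b hs => hτ.2 a b (hs.trans ?_)⟩,
      mem_insertions.2 ⟨u, v, rfl, rfl⟩⟩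
    · have := hτ.1 m
      simp only [List.count_append, List.count_cons] at this ⊢
      grind
    · exact (List.Sublist.refl u).append (((List.Sublist.refl v).cons _).cons _)
  · rintro ⟨σ, h, hτ⟩
    have hm : n + 1 ∉ σ := fun hc => by have := h.mem_iff.1 hc; omega
    have hf := filter_of_mem_insertions hm hτ
    obtain ⟨u, v, rfl, rfl⟩ := mem_insertions.1 hτ
    have hσ := isStirling_iff.1 h
    refine isStirling_iff.2 ⟨fun m => ?_, fun a b hs => ?_⟩
    · have := hσ.1 m
      have h0 := List.count_eq_zero.2 hm
      simp only [List.count_append, List.count_cons] at this h0 ⊢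
      grind
    · have hle : ∀ c ∈ u ++ (n + 1) :: (n + 1) :: v, c ≤ n + 1 := by
        intro c hc
        by_cases hcm : c = n + 1
        · omega
        · have := (h.mem_iff (m := c)).1 (by simpa [hcm] using hc)
          omega
      have ha := hle a (hs.subset (by simp))
      simp only [List.mem_append, not_or] at hm
      by_cases ham : a = n + 1
      · subst ham
        exfalso
        obtain ⟨l₁, l₂, he, h₁, h₂⟩ := List.sublist_append_iff.1 hs
        obtain _ | ⟨c, l₁⟩ := l₁
        · simp only [List.nil_append] at he
          subst he
          have h3 := List.cons_sublist_cons.1 h₂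
          cases h3 with
          | cons _ h4 => exact hm.2 (h4.subset (by simp))
          | cons_cons _ h4 => exact hm.2 (h4.subset (by simp))
        · obtain ⟨rfl, -⟩ := List.cons.inj he
          exact hm.1 (h₁.subset (by simp))
      · by_cases hbm : b = n + 1
        · omega
        · refine hσ.2 a b ?_
          have := hs.filter (· ≠ n + 1)
          rw [hf] at this
          simpa [ham, hbm] using this

theorem mem_words {n : ℕ} {σ : List ℕ} : σ ∈ words n ↔ IsStirling n σ := by
  induction n generalizing σ with
  | zero =>
    rw [words, List.mem_singleton]
    constructor
    · rintro rfl
      exact isStirling_iff.2 ⟨fun m => by rw [if_neg (by omega)]; rfl, by simp⟩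
    · intro h
      refine List.eq_nil_iff_forall_not_mem.2 fun m hm => ?_
      have := h.mem_iff.1 hm
      omega
  | succ n ih => simp only [words, List.mem_flatMap, ih, isStirling_succ_iff]

theorem nodup_words (n : ℕ) : (words n).Nodup := by
  induction n with
  | zero => simp [words]
  | succ n ih =>
    have hm : ∀ σ ∈ words n, n + 1 ∉ σ := fun σ hσ hc => by
      have := (mem_words.1 hσ).mem_iff.1 hc
      omega
    refine List.nodup_flatMap.2 ⟨fun σ hσ => nodup_insertions (hm σ hσ), ?_⟩
    refine ih.pairwise_of_forall_ne fun σ hσ ρ hρ hne τ hτ hτ' => hne ?_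
    rw [← filter_of_mem_insertions (hm σ hσ) hτ, filter_of_mem_insertions (hm ρ hρ) hτ']

/-- The variable recording the comparison of two consecutive letters. -/
noncomputable def step (a b : ℕ) : MvPolynomial (Fin 3) ℚ :=
  if a < b then X 0 else if a = b then X 1 else X 2

/-- The product of the steps of the word `a σ 0`. -/
noncomputable def weight : ℕ → List ℕ → MvPolynomial (Fin 3) ℚ
  | a, [] => step a 0
  | a, b :: l => step a b * weight b l

/-- The derivation `∂/∂x + ∂/∂y + ∂/∂z`. -/
noncomputable def diffSum : Derivation ℚ (MvPolynomial (Fin 3) ℚ) (MvPolynomial (Fin 3) ℚ) :=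
  mkDerivation ℚ fun _ => 1

theorem diffSum_step (a b : ℕ) : diffSum (step a b) = 1 := by
  unfold step diffSum
  split_ifs <;> exact mkDerivation_X _ _ _

theorem rename_diffSum (e : Equiv.Perm (Fin 3)) (p : MvPolynomial (Fin 3) ℚ) :
    rename e (diffSum p) = diffSum (rename e p) := by
  induction p using MvPolynomial.induction_on with
  | C a => simp [diffSum]
  | add p q hp hq => simp [hp, hq]
  | mul_X p i hp =>
    have hX (j : Fin 3) : diffSum (X j) = 1 := mkDerivation_X _ _ _
    simp [Derivation.leibniz, hp, hX]

theorem sum_weight_insertions {m a : ℕ} {σ : List ℕ} (ha : a < m) (hσ : ∀ b ∈ σ, b < m) :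
    ((insertions m σ).map (weight a)).sum = X 0 * X 1 * X 2 * diffSum (weight a σ) := by
  have h1 {c : ℕ} (hc : c < m) : step c m = X 0 := if_pos hc
  have h2 : step m m = X 1 := by simp [step]
  have h3 {c : ℕ} (hc : c < m) : step m c = X 2 := by
    rw [step, if_neg (by omega), if_neg (by omega)]
  induction σ generalizing a with
  | nil => simp [insertions, weight, diffSum_step, h1 ha, h2, h3 (Nat.zero_lt_of_lt ha), mul_assoc]
  | cons b l ih =>
    have hb : b < m := hσ b (by simp)
    have := ih hb fun c hc => hσ c (by simp [hc])
    have hmap : (((insertions m l).map (b :: ·)).map (weight a)).sum =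
        step a b * ((insertions m l).map (weight b)).sum := by
      rw [← List.sum_map_mul_left, List.map_map]
      rfl
    rw [insertions, List.map_cons, List.sum_cons, hmap, this]
    simp only [weight, Derivation.leibniz, diffSum_step, h1 ha, h2, h3 hb, smul_eq_mul]
    ring

/-- The total weight of all Stirling permutations of order `n`. -/
noncomputable def weightSum (n : ℕ) : MvPolynomial (Fin 3) ℚ :=
  ((words n).map (weight 0)).sum

theorem weightSum_succ (n : ℕ) :
    weightSum (n + 1) = X 0 * X 1 * X 2 * diffSum (weightSum n) := by
  have key : ∀ L : List (List ℕ), (∀ σ ∈ L, ∀ b ∈ σ, b < n + 1) →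
      ((L.flatMap (insertions (n + 1))).map (weight 0)).sum =
        X 0 * X 1 * X 2 * diffSum (L.map (weight 0)).sum := by
    intro L hL
    induction L with
    | nil => simp
    | cons σ L ih =>
      simp only [List.flatMap_cons, List.map_append, List.sum_append, List.map_cons,
        List.sum_cons, map_add, mul_add]
      rw [sum_weight_insertions n.succ_pos (hL σ (by simp)),
        ih fun ρ hρ => hL ρ (by simp [hρ])]
  refine key _ fun σ hσ b hb => ?_
  have := (mem_words.1 hσ).mem_iff.1 hb
  omega

theorem isSymmetric_weightSum_succ (n : ℕ) : (weightSum (n + 1)).IsSymmetric := by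
  have hxyz : (X 0 * X 1 * X 2 : MvPolynomial (Fin 3) ℚ).IsSymmetric := by
    intro e
    have := Equiv.prod_comp e (X : Fin 3 → MvPolynomial (Fin 3) ℚ)
    simpa [Fin.prod_univ_three] using this
  induction n with
  | zero =>
    have : weightSum 0 = step 0 0 := by simp [weightSum, words, weight]
    rw [weightSum_succ, this, diffSum_step, mul_one]
    exact hxyz
  | succ n ih =>
    rw [weightSum_succ]
    refine hxyz.mul fun e => ?_
    rw [rename_diffSum, ih e]

theorem weight_eq_prod (a : ℕ) (σ : List ℕ) :
    weight a σ = ∏ i ∈ Finset.range (σ.length + 1),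
      step ((a :: σ).getD i 0) ((a :: σ).getD (i + 1) 0) := by
  induction σ generalizing a with
  | nil => simp [weight]
  | cons b l ih =>
    rw [weight, ih, List.length_cons, Finset.prod_range_succ' _ (l.length + 1), mul_comm]
    rfl

theorem ent_eq (σ : List ℕ) (i : ℕ) : ent σ i = (0 :: σ).getD i 0 := by
  cases i <;> simp [ent]

theorem weight_eq_monomial {σ : List ℕ} (hne : σ ≠ []) (hpos : ∀ a ∈ σ, 0 < a) :
    weight 0 σ = X 0 ^ ascQ σ * X 1 ^ platQ σ * X 2 ^ desQ σ := by
  have hlen : 0 < σ.length := List.length_pos_iff.2 hne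
  have hent : ∀ i, 1 ≤ i → i ≤ σ.length → 0 < ent σ i := by
    intro i h1 h2
    rw [ent, if_neg (by omega), List.getD_eq_getElem _ _ (by omega)]
    exact hpos _ (List.getElem_mem _)
  have h0 : ent σ 0 = 0 := rfl
  have hlast : ent σ (σ.length + 1) = 0 := by simp [ent]
  have hasc : ascQ σ =
      ((Finset.range (σ.length + 1)).filter fun i => ent σ i < ent σ (i + 1)).card := by
    refine Finset.card_nbij' (· - 1) (· + 1) ?_ ?_ ?_ ?_
    · intro i hi
      simp only [Finset.coe_filter, Finset.mem_Icc, Finset.mem_range, Set.mem_ofPred_eq] at hi ⊢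
      rw [Nat.sub_add_cancel hi.1.1]
      exact ⟨by omega, hi.2⟩
    · intro i hi
      simp only [Finset.coe_filter, Finset.mem_Icc, Finset.mem_range, Set.mem_ofPred_eq] at hi ⊢
      have : i ≠ σ.length := by
        rintro rfl
        omega
      exact ⟨by omega, hi.2⟩
    · intro i hi
      simp only [Finset.coe_filter, Finset.mem_Icc, Set.mem_ofPred_eq] at hi
      exact Nat.sub_add_cancel hi.1.1
    · intro i _
      exact Nat.add_sub_cancel i 1
  have hplat : platQ σ =
      ((Finset.range (σ.length + 1)).filter fun i => ent σ i = ent σ (i + 1)).card := by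
    rw [platQ]
    congr 1
    ext i
    simp only [Finset.mem_filter, Finset.mem_Icc, Finset.mem_range]
    refine ⟨fun h => ⟨by omega, h.2⟩, fun h => ⟨⟨?_, ?_⟩, h.2⟩⟩
    · by_contra hi
      obtain rfl : i = 0 := by omega
      have := hent 1 le_rfl hlen
      simp only [zero_add] at h
      omega
    · by_contra hi
      obtain rfl : i = σ.length := by omega
      have := hent _ hlen le_rfl
      omega
  have hdes : desQ σ =
      ((Finset.range (σ.length + 1)).filter fun i => ent σ (i + 1) < ent σ i).card := by
    rw [desQ]
    congr 1
    ext i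
    simp only [Finset.mem_filter, Finset.mem_Icc, Finset.mem_range]
    refine ⟨fun h => ⟨by omega, h.2⟩, fun h => ⟨⟨?_, by omega⟩, h.2⟩⟩
    by_contra hi
    obtain rfl : i = 0 := by omega
    omega
  have hstep (a b : ℕ) : step a b =
      (if a < b then X 0 else 1) * (if a = b then X 1 else 1) * (if b < a then X 2 else 1) := by
    rcases lt_trichotomy a b with h | rfl | h
    · simp [step, h, h.ne, h.not_gt]
    · simp [step]
    · simp [step, h, h.ne', h.not_gt]
  simp only [weight_eq_prod, ← ent_eq, hstep, Finset.prod_mul_distrib, hasc, hplat, hdes,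
    ← Finset.prod_filter, Finset.prod_const]

theorem setOf_isStirling (n : ℕ) : {σ | IsStirling n σ} = ((words n).toFinset : Set (List ℕ)) := by
  ext σ
  simp [mem_words]

theorem Cpoly_eq_sum (n : ℕ) :
    Cpoly n = ∑ σ ∈ (words n).toFinset, X 0 ^ ascQ σ * X 1 ^ platQ σ * X 2 ^ desQ σ := by
  rw [Cpoly, setOf_isStirling]
  exact finsum_mem_coe_finset _ _

theorem isSymmetric_Cpoly (n : ℕ) : (Cpoly n).IsSymmetric := by
  obtain _ | n := n
  · have : Cpoly 0 = 1 := by simp [Cpoly_eq_sum, words, ascQ, platQ, desQ]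
    rw [this]
    exact IsSymmetric.one
  · have : Cpoly (n + 1) = weightSum (n + 1) := by
      rw [Cpoly_eq_sum, weightSum, ← List.sum_toFinset _ (nodup_words _)]
      refine Finset.sum_congr rfl fun σ hσ => (weight_eq_monomial ?_ fun a ha => ?_).symm
      all_goals have h := mem_words.1 (List.mem_toFinset.1 hσ)
      · exact List.ne_nil_of_mem ((h.mem_iff (m := 1)).2 (by omega))
      · exact (h.mem_iff.1 ha).1
    rw [this]
    exact isSymmetric_weightSum_succ n

theorem ncard_eq_coeff (n k : ℕ) (f : List ℕ → ℕ) :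
    (Set.ncard {σ : List ℕ | IsStirling n σ ∧ f σ = k} : ℚ) =
      (∑ σ ∈ (words n).toFinset, (Polynomial.X : Polynomial ℚ) ^ f σ).coeff k := by
  have : {σ : List ℕ | IsStirling n σ ∧ f σ = k} =
      ((words n).toFinset.filter fun σ => k = f σ : Finset (List ℕ)) := by
    ext σ
    simp [mem_words, eq_comm]
  rw [this, Set.ncard_coe_finset]
  simp [Polynomial.finsetSum_coeff, Polynomial.coeff_X_pow]

end Stirling

theorem Cpoly_symmetric (n : ℕ) :
    (Cpoly n).IsSymmetric ∧
    ∀ k : ℕ,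
      Set.ncard {σ : List ℕ | IsStirling n σ ∧ platQ σ = k} =
        Set.ncard {σ : List ℕ | IsStirling n σ ∧ desQ σ = k} := by
  refine ⟨Stirling.isSymmetric_Cpoly n, fun k => ?_⟩
  have h := congrArg (aeval ![1, (Polynomial.X : Polynomial ℚ), 1])
    (Stirling.isSymmetric_Cpoly n (Equiv.swap 1 2))
  have h0 : (Equiv.swap 1 2 : Equiv.Perm (Fin 3)) 0 = 0 := by decide
  simp only [Stirling.Cpoly_eq_sum, map_sum, map_mul, map_pow, rename_X, aeval_X, h0,
    Equiv.swap_apply_left, Equiv.swap_apply_right] at h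
  simp only [Matrix.cons_val, one_pow, one_mul, mul_one] at h
  rw [← Nat.cast_inj (R := ℚ), Stirling.ncard_eq_coeff, Stirling.ncard_eq_coeff, h]
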